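/- Let g be a C³ metric on U, V = (V_μ) a C³ covector field, and G : U → ℝ a C² positive function satisfying the continuity equation ∇_μ(G V^μ) = 0 on U, i.e. D_V G + G·∇_μ V^μ = 0 where ∇_μ V^μ := ∂_μ V^μ + Γ^μ_{μκ}V^κ. Then on U, for every ν: ∇_μ∇^μ V_ν = R_{σν}V^σ + ∇^λ ω_{λν} − (1/G)( ∇_ν(D_V G) + (∇_μ V^μ)(∇_ν G) ), where ∇_ν of a scalar means ∂_ν, ∇^λ ω_{λν} := g^{λκ}( ∂_κ ω_{λν} − Γ^ρ_{κλ}ω_{ρν} − Γ^ρ_{κν}ω_{λρ} ), and ∇_μ∇^μ V_ν := ∂_μ T^μ{}_ν + Γ^μ_{μκ}T^κ{}_ν − Γ^κ_{μν}T^μ{}_κ with T^μ{}_ν := g^{μκ}(∂_κ V_ν − Γ^ρ_{κν}V_ρ). -/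

import Mathlib

noncomputable section

/-- Points of spacetime: coordinates (x⁰,x¹,x²,x³). -/
abbrev Vec4 : Type := Fin 4 → ℝ

/-- Partial derivative ∂_μ f. -/
def pd (μ : Fin 4) (f : Vec4 → ℝ) (x : Vec4) : ℝ := fderiv ℝ f x (Pi.single μ 1)

/-- Christoffel symbols Γ^l_{μν} of the metric g, with pointwise inverse ginv. -/
def Chris (g ginv : Vec4 → Fin 4 → Fin 4 → ℝ) (l μ ν : Fin 4) (x : Vec4) : ℝ :=
  (1 / 2) * ∑ κ, ginv x l κ *
    (pd μ (fun y => g y κ ν) x + pd ν (fun y => g y κ μ) x - pd κ (fun y => g y μ ν) x)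

/-- Raised index V^μ := g^{μν} V_ν. -/
def Vup (ginv : Vec4 → Fin 4 → Fin 4 → ℝ) (V : Vec4 → Fin 4 → ℝ) (μ : Fin 4) (x : Vec4) : ℝ :=
  ∑ ν, ginv x μ ν * V x ν

/-- Vorticity two-form ω_{μν} := ∂_μ V_ν − ∂_ν V_μ. -/
def vort (V : Vec4 → Fin 4 → ℝ) (μ ν : Fin 4) (x : Vec4) : ℝ :=
  pd μ (fun y => V y ν) x - pd ν (fun y => V y μ) x

/-- The mixed tensor T^μ{}_ν := g^{μκ}(∂_κ V_ν − Γ^ρ_{κν} V_ρ) = ∇^μ V_ν. -/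
def Tmix (g ginv : Vec4 → Fin 4 → Fin 4 → ℝ) (V : Vec4 → Fin 4 → ℝ) (μ ν : Fin 4) (x : Vec4) : ℝ :=
  ∑ κ, ginv x μ κ * (pd κ (fun y => V y ν) x - ∑ ρ, Chris g ginv ρ κ ν x * V x ρ)

/-- Riemann curvature R^l{}_{σμν} := ∂_μ Γ^l_{νσ} − ∂_ν Γ^l_{μσ} + Γ^l_{μκ}Γ^κ_{νσ} − Γ^l_{νκ}Γ^κ_{μσ}. -/
def Riem (g ginv : Vec4 → Fin 4 → Fin 4 → ℝ) (l σ μ ν : Fin 4) (x : Vec4) : ℝ :=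
  pd μ (fun y => Chris g ginv l ν σ y) x - pd ν (fun y => Chris g ginv l μ σ y) x
    + (∑ κ, Chris g ginv l μ κ x * Chris g ginv κ ν σ x)
    - ∑ κ, Chris g ginv l ν κ x * Chris g ginv κ μ σ x

/-- Ricci curvature R_{σν} := R^μ{}_{σμν}. -/
def RicciT (g ginv : Vec4 → Fin 4 → Fin 4 → ℝ) (σ ν : Fin 4) (x : Vec4) : ℝ :=
  ∑ μ, Riem g ginv μ σ μ ν x

/-- ∇^λ ω_{λν} := g^{λκ}(∂_κ ω_{λν} − Γ^ρ_{κλ} ω_{ρν} − Γ^ρ_{κν} ω_{λρ}). -/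
def divVort (g ginv : Vec4 → Fin 4 → Fin 4 → ℝ) (V : Vec4 → Fin 4 → ℝ) (ν : Fin 4) (x : Vec4) : ℝ :=
  ∑ l, ∑ κ, ginv x l κ *
    (pd κ (fun y => vort V l ν y) x
      - (∑ ρ, Chris g ginv ρ κ l x * vort V ρ ν x)
      - ∑ ρ, Chris g ginv ρ κ ν x * vort V l ρ x)

/-- ∇_μ V^μ := ∂_μ V^μ + Γ^μ_{μκ} V^κ. -/
def divUp (g ginv : Vec4 → Fin 4 → Fin 4 → ℝ) (V : Vec4 → Fin 4 → ℝ) (x : Vec4) : ℝ :=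
  ∑ μ, (pd μ (fun y => Vup ginv V μ y) x + ∑ κ, Chris g ginv μ μ κ x * Vup ginv V κ x)

/-- D_V G := V^μ ∂_μ G. -/
def DVf (ginv : Vec4 → Fin 4 → Fin 4 → ℝ) (V : Vec4 → Fin 4 → ℝ) (G : Vec4 → ℝ) (x : Vec4) : ℝ :=
  ∑ μ, Vup ginv V μ x * pd μ G x

/-! ### Calculus of the partial derivative `pd` -/

lemma pd_congr_on {U : Set Vec4} (hU : IsOpen U) {f h : Vec4 → ℝ}
    (hfh : ∀ y ∈ U, f y = h y) {x : Vec4} (hx : x ∈ U) (μ : Fin 4) : pd μ f x = pd μ h x := by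
  have : f =ᶠ[nhds x] h := Filter.eventually_of_mem (hU.mem_nhds hx) hfh
  unfold pd
  rw [this.fderiv_eq]

lemma pd_add_at {f h : Vec4 → ℝ} {x : Vec4} (hf : DifferentiableAt ℝ f x)
    (hh : DifferentiableAt ℝ h x) (μ : Fin 4) :
    pd μ (fun y => f y + h y) x = pd μ f x + pd μ h x := by
  unfold pd
  rw [fderiv_fun_add hf hh]
  rfl

lemma pd_mul_at {f h : Vec4 → ℝ} {x : Vec4} (hf : DifferentiableAt ℝ f x)
    (hh : DifferentiableAt ℝ h x) (μ : Fin 4) :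
    pd μ (fun y => f y * h y) x = pd μ f x * h x + f x * pd μ h x := by
  unfold pd
  rw [fderiv_fun_mul hf hh]
  simp
  ring

lemma pd_sum_at {f : Fin 4 → Vec4 → ℝ} {x : Vec4} (hf : ∀ i, DifferentiableAt ℝ (f i) x)
    (μ : Fin 4) : pd μ (fun y => ∑ i, f i y) x = ∑ i, pd μ (f i) x := by
  unfold pd
  rw [fderiv_fun_sum (fun i _ => hf i)]
  simp

lemma pd_const_at (c : ℝ) (x : Vec4) (μ : Fin 4) : pd μ (fun _ => c) x = 0 := by
  simp [pd]

lemma pd_contDiffAt {f : Vec4 → ℝ} {x : Vec4} {m n : WithTop ℕ∞} (hf : ContDiffAt ℝ n f x)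
    (hmn : m + 1 ≤ n) (μ : Fin 4) : ContDiffAt ℝ m (pd μ f) x := by
  have := hf.fderiv_right hmn
  exact this.clm_apply contDiffAt_const

lemma pd_comm_at {f : Vec4 → ℝ} {x : Vec4} (hf : ContDiffAt ℝ 2 f x) (μ ν : Fin 4) :
    pd μ (pd ν f) x = pd ν (pd μ f) x := by
  have hs : IsSymmSndFDerivAt ℝ f x := hf.isSymmSndFDerivAt (by simp)
  have hd : DifferentiableAt ℝ (fderiv ℝ f) x :=
    (hf.fderiv_right (m := 1) (by norm_num)).differentiableAt (by norm_num)
  have key : ∀ a b : Fin 4, pd a (pd b f) x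
      = fderiv ℝ (fderiv ℝ f) x (Pi.single a 1) (Pi.single b 1) := by
    intro a b
    have : fderiv ℝ (fun y => fderiv ℝ f y (Pi.single b 1)) x
        = (fderiv ℝ (fderiv ℝ f) x).flip (Pi.single b 1) := by
      rw [fderiv_clm_apply hd (differentiableAt_const _)]
      simp
    change fderiv ℝ (fun y => fderiv ℝ f y (Pi.single b 1)) x (Pi.single a 1) = _
    rw [this]
    rfl
  rw [key, key]
  exact hs _ _

/-! ### The inverse metric -/

lemma ginv_eq_inv {A B : Fin 4 → Fin 4 → ℝ}
    (h : ∀ μ ν, (∑ κ, A μ κ * B κ ν) = if μ = ν then 1 else 0) :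
    Matrix.of A * Matrix.of B = 1 := by
  ext μ ν
  simp [Matrix.mul_apply, h, Matrix.one_apply]

lemma ginv_left {A B : Fin 4 → Fin 4 → ℝ}
    (h : ∀ μ ν, (∑ κ, A μ κ * B κ ν) = if μ = ν then 1 else 0) (μ ν : Fin 4) :
    (∑ κ, B μ κ * A κ ν) = if μ = ν then 1 else 0 := by
  have h1 := mul_eq_one_comm.mp (ginv_eq_inv h)
  have := congrFun (congrFun h1 μ) ν
  simpa [Matrix.mul_apply, Matrix.one_apply] using this

lemma ginv_symm {A B : Fin 4 → Fin 4 → ℝ} (hs : ∀ μ ν, A μ ν = A ν μ)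
    (h : ∀ μ ν, (∑ κ, A μ κ * B κ ν) = if μ = ν then 1 else 0) (μ ν : Fin 4) :
    B μ ν = B ν μ := by
  have h1 := ginv_eq_inv h
  have hA : (Matrix.of A).transpose = Matrix.of A := by
    ext i j; simp [hs i j]
  have h2 : (Matrix.of B).transpose * Matrix.of A = 1 := by
    rw [← hA, ← Matrix.transpose_mul, h1, Matrix.transpose_one]
  have h3 : (Matrix.of B).transpose = Matrix.of B := left_inv_eq_right_inv h2 h1
  have := congrFun (congrFun h3 ν) μ
  simpa using this

lemma det_contDiffAt {n : WithTop ℕ∞} {x : Vec4} (M : Vec4 → Matrix (Fin 4) (Fin 4) ℝ)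
    (hM : ∀ i j, ContDiffAt ℝ n (fun y => M y i j) x) :
    ContDiffAt ℝ n (fun y => (M y).det) x := by
  simp only [Matrix.det_apply, Units.smul_def, zsmul_eq_mul]
  exact ContDiffAt.sum fun σ _ => contDiffAt_const.mul (contDiffAt_prod fun i _ => hM _ _)

lemma ginv_contDiffAt {U : Set Vec4} (hU : IsOpen U) {g ginv : Vec4 → Fin 4 → Fin 4 → ℝ}
    (hinv : ∀ x ∈ U, ∀ μ ν, (∑ κ, g x μ κ * ginv x κ ν) = if μ = ν then 1 else 0)
    {n : WithTop ℕ∞} {x : Vec4} (hx : x ∈ U)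
    (hg : ∀ μ ν, ContDiffAt ℝ n (fun x => g x μ ν) x) (μ ν : Fin 4) :
    ContDiffAt ℝ n (fun x => ginv x μ ν) x := by
  have hdet : ∀ y ∈ U, (Matrix.of (g y)).det ≠ 0 := by
    intro y hy h0
    have := congrArg Matrix.det (ginv_eq_inv (hinv y hy))
    rw [Matrix.det_mul, h0] at this
    simp at this
  have heq : ∀ y ∈ U, ginv y μ ν
      = ((Matrix.of (g y)).det)⁻¹ * (Matrix.of (g y)).adjugate μ ν := by
    intro y hy
    have h1 := Matrix.inv_eq_right_inv (ginv_eq_inv (hinv y hy))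
    have h2 := congrFun (congrFun h1 μ) ν
    rw [Matrix.inv_def] at h2
    simp only [Ring.inverse_eq_inv', Matrix.smul_apply, smul_eq_mul, Matrix.of_apply] at h2
    exact h2.symm
  have hev : (fun y => ginv y μ ν) =ᶠ[nhds x]
      fun y => ((Matrix.of (g y)).det)⁻¹ * (Matrix.of (g y)).adjugate μ ν :=
    Filter.eventually_of_mem (hU.mem_nhds hx) heq
  refine ContDiffAt.congr_of_eventuallyEq ?_ hev
  refine ((det_contDiffAt _ fun i j => hg i j).inv (hdet x hx)).mul ?_
  simp only [Matrix.adjugate_apply]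
  refine det_contDiffAt _ fun i j => ?_
  by_cases h : i = ν
  · subst h
    simp only [Matrix.updateRow_self]
    exact contDiffAt_const
  · simp only [Matrix.updateRow_ne h]
    exact hg i j

/-! ### Christoffel symbols -/

lemma Chris_symm {U : Set Vec4} (hU : IsOpen U) {g : Vec4 → Fin 4 → Fin 4 → ℝ}
    (ginv : Vec4 → Fin 4 → Fin 4 → ℝ)
    (hsymm : ∀ x ∈ U, ∀ μ ν, g x μ ν = g x ν μ) {x : Vec4} (hx : x ∈ U) (l μ ν : Fin 4) :
    Chris g ginv l μ ν x = Chris g ginv l ν μ x := by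
  unfold Chris
  congr 1
  refine Finset.sum_congr rfl fun κ _ => ?_
  rw [pd_congr_on hU (fun y hy => hsymm y hy μ ν) hx κ]
  ring

lemma Chris_contDiffAt {g ginv : Vec4 → Fin 4 → Fin 4 → ℝ} {x : Vec4}
    (hg : ∀ μ ν, ContDiffAt ℝ 3 (fun x => g x μ ν) x)
    (hgi : ∀ μ ν, ContDiffAt ℝ 3 (fun x => ginv x μ ν) x) (l μ ν : Fin 4) :
    ContDiffAt ℝ 2 (fun y => Chris g ginv l μ ν y) x := by
  unfold Chris
  have h : ∀ a b c, ContDiffAt ℝ 2 (fun y => pd a (fun z => g z b c) y) x :=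
    fun a b c => pd_contDiffAt (hg b c) (by norm_num) a
  exact contDiffAt_const.mul (ContDiffAt.sum fun κ _ =>
    ((hgi l κ).of_le (by norm_num)).mul (((h _ _ _).add (h _ _ _)).sub (h _ _ _)))

/-- Metric compatibility for the inverse metric. -/
lemma pd_ginv {U : Set Vec4} (hU : IsOpen U) {g ginv : Vec4 → Fin 4 → Fin 4 → ℝ}
    (hsymm : ∀ x ∈ U, ∀ μ ν, g x μ ν = g x ν μ)
    (hinv : ∀ x ∈ U, ∀ μ ν, (∑ κ, g x μ κ * ginv x κ ν) = if μ = ν then 1 else 0)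
    {x : Vec4} (hx : x ∈ U)
    (hg : ∀ μ ν, ContDiffAt ℝ 3 (fun x => g x μ ν) x)
    (hgi : ∀ μ ν, ContDiffAt ℝ 3 (fun x => ginv x μ ν) x) (ν a b : Fin 4) :
    pd ν (fun y => ginv y a b) x
      = - (∑ r, Chris g ginv a ν r x * ginv x r b) - ∑ r, Chris g ginv b ν r x * ginv x a r := by
  have dg : ∀ i j, DifferentiableAt ℝ (fun y => g y i j) x :=
    fun i j => (hg i j).differentiableAt (by norm_num)
  have dgi : ∀ i j, DifferentiableAt ℝ (fun y => ginv y i j) x :=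
    fun i j => (hgi i j).differentiableAt (by norm_num)
  have is := ginv_symm (hsymm x hx) (hinv x hx)
  -- differentiate `g * ginv = 1`
  have h1 : ∀ c, (∑ k, (pd ν (fun y => g y c k) x * ginv x k b
      + g x c k * pd ν (fun y => ginv y k b) x)) = 0 := by
    intro c
    have e := pd_congr_on hU (fun y hy => hinv y hy c b) hx ν
    rw [pd_const_at, pd_sum_at (fun k => (dg c k).fun_mul (dgi k b))] at e
    rw [← e]
    exact Finset.sum_congr rfl fun k _ => (pd_mul_at (dg c k) (dgi k b) ν).symm
  have h2 : pd ν (fun y => ginv y a b) x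
      = - ∑ c, ∑ k, ginv x a c * pd ν (fun y => g y c k) x * ginv x k b := by
    have e : (∑ c, ginv x a c * ∑ k, (pd ν (fun y => g y c k) x * ginv x k b
      + g x c k * pd ν (fun y => ginv y k b) x)) = 0 := by simp [h1]
    have e2 : (∑ c, ginv x a c * ∑ k, (pd ν (fun y => g y c k) x * ginv x k b
        + g x c k * pd ν (fun y => ginv y k b) x))
        = (∑ c, ∑ k, ginv x a c * pd ν (fun y => g y c k) x * ginv x k b)
          + ∑ k, (∑ c, ginv x a c * g x c k) * pd ν (fun y => ginv y k b) x := by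
      simp only [Finset.mul_sum, Finset.sum_mul]
      rw [Finset.sum_comm (f := fun k c => ginv x a c * g x c k * pd ν (fun y => ginv y k b) x),
        ← Finset.sum_add_distrib]
      refine Finset.sum_congr rfl fun c _ => ?_
      rw [← Finset.sum_add_distrib]
      exact Finset.sum_congr rfl fun k _ => by ring
    rw [e2] at e
    simp only [ginv_left (hinv x hx), ite_mul, one_mul, zero_mul, Finset.sum_ite_eq,
      Finset.mem_univ, if_true] at e
    linarith
  have h3 : (∑ r, Chris g ginv b ν r x * ginv x a r)
      = ∑ c, ∑ k, (1/2) * (ginv x a c * ginv x k b * (pd ν (fun y => g y c k) x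
          + pd c (fun y => g y ν k) x - pd k (fun y => g y ν c) x)) := by
    unfold Chris
    simp only [Finset.mul_sum, Finset.sum_mul]
    refine Finset.sum_congr rfl fun c _ => Finset.sum_congr rfl fun k _ => ?_
    rw [is b k, pd_congr_on hU (fun y hy => hsymm y hy k c) hx ν,
      pd_congr_on hU (fun y hy => hsymm y hy k ν) hx c]
    ring
  have h4 : (∑ r, Chris g ginv a ν r x * ginv x r b)
      = ∑ c, ∑ k, (1/2) * (ginv x a c * ginv x k b * (pd ν (fun y => g y c k) x
          - pd c (fun y => g y ν k) x + pd k (fun y => g y ν c) x)) := by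
    unfold Chris
    simp only [Finset.mul_sum, Finset.sum_mul]
    rw [Finset.sum_comm]
    refine Finset.sum_congr rfl fun c _ => Finset.sum_congr rfl fun k _ => ?_
    rw [pd_congr_on hU (fun y hy => hsymm y hy c ν) hx k]
    ring
  rw [h2, h3, h4, ← Finset.sum_neg_distrib, ← Finset.sum_neg_distrib, ← Finset.sum_sub_distrib]
  refine Finset.sum_congr rfl fun c _ => ?_
  rw [← Finset.sum_neg_distrib, ← Finset.sum_neg_distrib, ← Finset.sum_sub_distrib]
  exact Finset.sum_congr rfl fun k _ => by ring

/-- `∇_ν V^μ`. -/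
def gradUp (g ginv : Vec4 → Fin 4 → Fin 4 → ℝ) (W : Fin 4 → Vec4 → ℝ) (ν μ : Fin 4)
    (x : Vec4) : ℝ :=
  pd ν (W μ) x + ∑ κ, Chris g ginv μ ν κ x * W κ x

/-- `∇_μ∇_ν W^μ = R_{σν} W^σ + ∂_ν (∇_μ W^μ)`. -/
lemma commute_div {U : Set Vec4} (hU : IsOpen U) {g ginv : Vec4 → Fin 4 → Fin 4 → ℝ}
    (hsymm : ∀ x ∈ U, ∀ μ ν, g x μ ν = g x ν μ) {x : Vec4} (hx : x ∈ U)
    (hC : ∀ l μ ν, ContDiffAt ℝ 2 (fun y => Chris g ginv l μ ν y) x)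
    {W : Fin 4 → Vec4 → ℝ} (hW : ∀ μ, ContDiffAt ℝ 3 (W μ) x) (ν : Fin 4) :
    (∑ μ, pd μ (fun y => gradUp g ginv W ν μ y) x)
      + (∑ μ, ∑ κ, Chris g ginv μ μ κ x * gradUp g ginv W ν κ x)
      - (∑ μ, ∑ κ, Chris g ginv κ μ ν x * gradUp g ginv W κ μ x)
    = (∑ σ, RicciT g ginv σ ν x * W σ x)
      + pd ν (fun y => ∑ μ, gradUp g ginv W μ μ y) x := by
  have dC : ∀ l μ ν, DifferentiableAt ℝ (fun y => Chris g ginv l μ ν y) x :=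
    fun l μ ν => (hC l μ ν).differentiableAt (by norm_num)
  have dW : ∀ μ, DifferentiableAt ℝ (W μ) x := fun μ => (hW μ).differentiableAt (by norm_num)
  have dpW : ∀ ν μ, DifferentiableAt ℝ (pd ν (W μ)) x := fun ν μ =>
    (pd_contDiffAt (m := 2) (hW μ) (by norm_num) ν).differentiableAt (by norm_num)
  have dS : ∀ a b, DifferentiableAt ℝ (fun y => ∑ κ, Chris g ginv b a κ y * W κ y) x :=
    fun a b => DifferentiableAt.fun_sum fun κ _ => (dC b a κ).mul (dW κ)
  have dB : ∀ a b, DifferentiableAt ℝ (fun y => gradUp g ginv W a b y) x :=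
    fun a b => (dpW a b).add (dS a b)
  have hB : ∀ c a b, pd c (fun y => gradUp g ginv W a b y) x = pd c (pd a (W b)) x
      + ∑ κ, (pd c (fun y => Chris g ginv b a κ y) x * W κ x
        + Chris g ginv b a κ x * pd c (W κ) x) := by
    intro c a b
    unfold gradUp
    rw [pd_add_at (dpW a b) (dS a b), pd_sum_at (fun κ => (dC b a κ).fun_mul (dW κ))]
    congr 1
    exact Finset.sum_congr rfl fun κ _ => pd_mul_at (dC b a κ) (dW κ) c
  rw [pd_sum_at (fun μ => dB μ μ)]
  simp only [hB]
  have hc : ∀ μ, pd μ (pd ν (W μ)) x = pd ν (pd μ (W μ)) x := fun μ =>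
    pd_comm_at ((hW μ).of_le (by norm_num)) μ ν
  simp only [hc, gradUp, RicciT, Riem]
  simp only [Chris_symm hU ginv hsymm hx _ _ ν]
  simp only [Fin.sum_univ_four]
  ring

/-- `∇_ν V^μ = g^{μκ} ∇_ν V_κ`. -/
lemma gradUp_Vup {g ginv : Vec4 → Fin 4 → Fin 4 → ℝ} {V : Vec4 → Fin 4 → ℝ} {x : Vec4}
    (hgi : ∀ μ ν, DifferentiableAt ℝ (fun x => ginv x μ ν) x)
    (hV : ∀ μ, DifferentiableAt ℝ (fun x => V x μ) x)
    (hcompat : ∀ ν a b, pd ν (fun y => ginv y a b) x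
      = - (∑ r, Chris g ginv a ν r x * ginv x r b) - ∑ r, Chris g ginv b ν r x * ginv x a r)
    (ν μ : Fin 4) :
    gradUp g ginv (Vup ginv V) ν μ x = ∑ κ, ginv x μ κ *
      (pd ν (fun y => V y κ) x - ∑ ρ, Chris g ginv ρ ν κ x * V x ρ) := by
  have h : pd ν (Vup ginv V μ) x = ∑ κ, (pd ν (fun y => ginv y μ κ) x * V x κ
      + ginv x μ κ * pd ν (fun y => V y κ) x) := by
    change pd ν (fun y => ∑ κ, ginv y μ κ * V y κ) x = _
    rw [pd_sum_at (fun κ => (hgi μ κ).fun_mul (hV κ))]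
    exact Finset.sum_congr rfl fun κ _ => pd_mul_at (hgi μ κ) (hV κ) ν
  unfold gradUp
  rw [h]
  simp only [hcompat, Vup, Fin.sum_univ_four]
  ring

/-- The divergence of `g^{μκ} ω_{κν}` is `∇^λ ω_{λν}`. -/
lemma div_raise {g ginv : Vec4 → Fin 4 → Fin 4 → ℝ} {V : Vec4 → Fin 4 → ℝ} {x : Vec4}
    (his : ∀ μ ν, ginv x μ ν = ginv x ν μ)
    (hgi : ∀ μ ν, DifferentiableAt ℝ (fun x => ginv x μ ν) x)
    (hw : ∀ μ ν, DifferentiableAt ℝ (fun x => vort V μ ν x) x)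
    (hcompat : ∀ ν a b, pd ν (fun y => ginv y a b) x
      = - (∑ r, Chris g ginv a ν r x * ginv x r b) - ∑ r, Chris g ginv b ν r x * ginv x a r)
    (ν : Fin 4) :
    (∑ μ, pd μ (fun y => ∑ κ, ginv y μ κ * vort V κ ν y) x)
      + (∑ μ, ∑ κ, Chris g ginv μ μ κ x * ∑ r, ginv x κ r * vort V r ν x)
      - (∑ μ, ∑ κ, Chris g ginv κ μ ν x * ∑ r, ginv x μ r * vort V r κ x)
    = divVort g ginv V ν x := by
  have h : ∀ μ, pd μ (fun y => ∑ κ, ginv y μ κ * vort V κ ν y) x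
      = ∑ κ, (pd μ (fun y => ginv y μ κ) x * vort V κ ν x
        + ginv x μ κ * pd μ (fun y => vort V κ ν y) x) := by
    intro μ
    rw [pd_sum_at (fun κ => (hgi μ κ).fun_mul (hw κ ν))]
    exact Finset.sum_congr rfl fun κ _ => pd_mul_at (hgi μ κ) (hw κ ν) μ
  have hd : divVort g ginv V ν x = ∑ κ, ∑ l, ginv x κ l *
    (pd κ (fun y => vort V l ν y) x
      - (∑ ρ, Chris g ginv ρ κ l x * vort V ρ ν x)
      - ∑ ρ, Chris g ginv ρ κ ν x * vort V l ρ x) := by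
    unfold divVort
    rw [Finset.sum_comm]
    refine Finset.sum_congr rfl fun κ _ => Finset.sum_congr rfl fun l _ => ?_
    rw [his l κ]
  rw [hd]
  simp only [h]
  simp only [hcompat, Fin.sum_univ_four]
  ring

/-- Equation (1.33): the interior wave equation for the fluid velocity,
∇_μ∇^μ V_ν = R_{σν}V^σ + ∇^λ ω_{λν} − (1/G)(∇_ν(D_V G) + (∇_μ V^μ)(∇_ν G)),
derived from the continuity equation ∇_μ(G V^μ) = 0. -/
theorem interior_wave_equation_velocity
    (U : Set Vec4) (hU : IsOpen U)
    (g ginv : Vec4 → Fin 4 → Fin 4 → ℝ)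
    (hsymm : ∀ x ∈ U, ∀ μ ν, g x μ ν = g x ν μ)
    (hinv : ∀ x ∈ U, ∀ μ ν, (∑ κ, g x μ κ * ginv x κ ν) = if μ = ν then 1 else 0)
    (hg : ∀ μ ν, ContDiffOn ℝ 3 (fun x => g x μ ν) U)
    (V : Vec4 → Fin 4 → ℝ)
    (hV : ∀ μ, ContDiffOn ℝ 3 (fun x => V x μ) U)
    (G : Vec4 → ℝ) (hG : ContDiffOn ℝ 2 G U) (hGpos : ∀ x ∈ U, 0 < G x)
    (hcont : ∀ x ∈ U, DVf ginv V G x + G x * divUp g ginv V x = 0) :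
    ∀ x ∈ U, ∀ ν,
      (∑ μ, pd μ (fun y => Tmix g ginv V μ ν y) x)
        + (∑ μ, ∑ κ, Chris g ginv μ μ κ x * Tmix g ginv V κ ν x)
        - (∑ μ, ∑ κ, Chris g ginv κ μ ν x * Tmix g ginv V μ κ x)
      = (∑ σ, RicciT g ginv σ ν x * Vup ginv V σ x)
        + divVort g ginv V ν x
        - (1 / G x) * (pd ν (fun y => DVf ginv V G y) x + divUp g ginv V x * pd ν G x) := by
  intro x hx ν
  have cg : ∀ y ∈ U, ∀ μ ν, ContDiffAt ℝ 3 (fun x => g x μ ν) y :=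
    fun y hy μ ν => (hg μ ν).contDiffAt (hU.mem_nhds hy)
  have cgi : ∀ y ∈ U, ∀ μ ν, ContDiffAt ℝ 3 (fun x => ginv x μ ν) y :=
    fun y hy μ ν => ginv_contDiffAt hU hinv hy (cg y hy) μ ν
  have cV : ∀ y ∈ U, ∀ μ, ContDiffAt ℝ 3 (fun x => V x μ) y :=
    fun y hy μ => (hV μ).contDiffAt (hU.mem_nhds hy)
  have dgi : ∀ y ∈ U, ∀ μ ν, DifferentiableAt ℝ (fun x => ginv x μ ν) y :=
    fun y hy μ ν => (cgi y hy μ ν).differentiableAt (by norm_num)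
  have dV : ∀ y ∈ U, ∀ μ, DifferentiableAt ℝ (fun x => V x μ) y :=
    fun y hy μ => (cV y hy μ).differentiableAt (by norm_num)
  have hcompat := fun y (hy : y ∈ U) => pd_ginv hU hsymm hinv hy (cg y hy) (cgi y hy)
  have hC := fun l a b => Chris_contDiffAt (cg x hx) (cgi x hx) l a b
  have cW : ∀ μ, ContDiffAt ℝ 3 (Vup ginv V μ) x := fun μ =>
    ContDiffAt.sum (f := fun κ y => ginv y μ κ * V y κ) fun κ _ => (cgi x hx μ κ).mul (cV x hx κ)
  have dw : ∀ a b, DifferentiableAt ℝ (fun x => vort V a b x) x := fun a b =>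
    ((pd_contDiffAt (m := 2) (cV x hx b) (by norm_num) a).sub
      (pd_contDiffAt (m := 2) (cV x hx a) (by norm_num) b)).differentiableAt (by norm_num)
  have dB : ∀ a b, DifferentiableAt ℝ (fun y => gradUp g ginv (Vup ginv V) a b y) x := fun a b =>
    ((pd_contDiffAt (m := 2) (cW b) (by norm_num) a).differentiableAt (by norm_num)).add
      (DifferentiableAt.fun_sum fun κ _ => ((hC b a κ).differentiableAt (by norm_num)).mul
        ((cW κ).differentiableAt (by norm_num)))
  -- decomposition of `∇^μ V_ν`
  have hT : ∀ y ∈ U, ∀ μ ν, Tmix g ginv V μ ν y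
      = (∑ κ, ginv y μ κ * vort V κ ν y) + gradUp g ginv (Vup ginv V) ν μ y := by
    intro y hy μ ν
    rw [gradUp_Vup (dgi y hy) (dV y hy) (hcompat y hy), ← Finset.sum_add_distrib]
    unfold Tmix vort
    refine Finset.sum_congr rfl fun κ _ => ?_
    simp only [Chris_symm hU ginv hsymm hy _ κ ν]
    ring
  have hpT : ∀ μ, pd μ (fun y => Tmix g ginv V μ ν y) x
      = pd μ (fun y => ∑ κ, ginv y μ κ * vort V κ ν y) x
        + pd μ (fun y => gradUp g ginv (Vup ginv V) ν μ y) x := by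
    intro μ
    rw [pd_congr_on hU (fun y hy => hT y hy μ ν) hx μ]
    exact pd_add_at (DifferentiableAt.fun_sum fun κ _ => (dgi x hx μ κ).fun_mul (dw κ ν))
      (dB ν μ) μ
  have h1 := div_raise (ginv_symm (hsymm x hx) (hinv x hx)) (dgi x hx) dw (hcompat x hx) ν
  have h2 := commute_div hU hsymm hx hC cW ν
  -- the continuity equation
  have ddiv : DifferentiableAt ℝ (fun y => ∑ μ, gradUp g ginv (Vup ginv V) μ μ y) x :=
    DifferentiableAt.fun_sum fun μ _ => dB μ μ
  have dG : DifferentiableAt ℝ G x :=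
    (hG.contDiffAt (hU.mem_nhds hx)).differentiableAt (by norm_num)
  have hdiv : divUp g ginv V x = ∑ μ, gradUp g ginv (Vup ginv V) μ μ x := rfl
  have hD : pd ν (fun y => DVf ginv V G y) x
      = - (pd ν G x * divUp g ginv V x
        + G x * pd ν (fun y => ∑ μ, gradUp g ginv (Vup ginv V) μ μ y) x) := by
    have e : ∀ y ∈ U, DVf ginv V G y
        = (-1) * (G y * ∑ μ, gradUp g ginv (Vup ginv V) μ μ y) := by
      intro y hy
      have h : DVf ginv V G y + G y * ∑ μ, gradUp g ginv (Vup ginv V) μ μ y = 0 := hcont y hy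
      linarith
    rw [pd_congr_on hU e hx ν, pd_mul_at (differentiableAt_const _) (dG.fun_mul ddiv),
      pd_mul_at dG ddiv, pd_const_at, hdiv]
    ring
  have hlast : (1 / G x) * (pd ν (fun y => DVf ginv V G y) x + divUp g ginv V x * pd ν G x)
      = - pd ν (fun y => ∑ μ, gradUp g ginv (Vup ginv V) μ μ y) x := by
    have hne := (hGpos x hx).ne'
    rw [hD]
    field_simp
    ring
  rw [hlast, ← h1]
  simp only [hpT, hT x hx, mul_add, Finset.sum_add_distrib] at h2 ⊢
  linarith
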